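/- Let G be a finitely generated nilpotent group with finite symmetric generating set B_G and word length |·|_G. Then there exists K > 0, depending only on G and B_G, with the following property: for every g ∈ G with |g|_G = n there exist k ≤ K, elements s₁, s₂, …, s_k ∈ B_G (not necessarily distinct) and integers a₁, a₂, …, a_k ≥ 0 with a₁ + a₂ + ⋯ + a_k ≤ K·n such that g = s₁^{a₁} s₂^{a₂} ⋯ s_k^{a_k}. -/

import Mathlib

/-- Word length of `g` with respect to a generating set `S`:
the least `n` such that `g` is a product of `n` elements of `S`. -/
noncomputable def wlen {G : Type*} [Group G] (S : Set G) (g : G) : ℕ :=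
  sInf {n : ℕ | ∃ l : List G, (∀ s ∈ l, s ∈ S) ∧ l.length = n ∧ l.prod = g}

open scoped commutatorElement

/-- The value of a formal bracket in the letters `α`, read as an iterated commutator. -/
def commEval {G α : Type*} [Group G] (f : α → G) : FreeMagma α → G
  | .of a => f a
  | .mul x y => ⁅commEval f x, commEval f y⁆

/-- The value of a word whose letters are formal commutators. -/
def wordEval {G α : Type*} [Group G] (f : α → G) (w : List (FreeMagma α)) : G :=
  (w.map (commEval f)).prod

/-- The weighted letter count of a word: a letter of weight `k` contributes `q ^ k`. -/
def potential {α : Type*} (q : ℝ) (w : List (FreeMagma α)) : ℝ :=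
  (w.map fun t => q ^ t.length).sum

/-- The word obtained from `w` by moving the letter `T` from its left to its right. -/
def crossWord {α : Type*} (T : FreeMagma α) (w : List (FreeMagma α)) : List (FreeMagma α) :=
  w.flatMap fun t => [T * t, t]

section Words

variable {G α : Type*} [Group G] (f : α → G)

theorem commEval_mul (x y : FreeMagma α) : commEval f (x * y) = ⁅commEval f x, commEval f y⁆ := rfl

theorem commEval_of (a : α) : commEval f (.of a) = f a := rfl

theorem FreeMagma.length_mul' (x y : FreeMagma α) : (x * y).length = x.length + y.length := rfl

theorem FreeMagma.mul_inj_right {T x y : FreeMagma α} : T * x = T * y ↔ x = y := by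
  refine ⟨fun h => ?_, fun h => h ▸ rfl⟩
  change FreeMagma.mul T x = FreeMagma.mul T y at h
  cases h
  rfl

theorem FreeMagma.mul_inj_left {T x t y : FreeMagma α} (h : T * x = t * y) : T = t := by
  change FreeMagma.mul T x = FreeMagma.mul t y at h
  cases h
  rfl

theorem FreeMagma.mul_ne_right (T x : FreeMagma α) : T * x ≠ x := fun h => by
  have := congrArg FreeMagma.length h
  have := T.length_pos
  rw [FreeMagma.length_mul'] at *
  omega

@[simp] theorem wordEval_nil : wordEval f [] = 1 := rfl

@[simp] theorem wordEval_cons (t : FreeMagma α) (w : List (FreeMagma α)) :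
    wordEval f (t :: w) = commEval f t * wordEval f w := by simp [wordEval]

theorem wordEval_replicate (n : ℕ) (t : FreeMagma α) :
    wordEval f (List.replicate n t) = commEval f t ^ n := by simp [wordEval]

@[simp] theorem potential_nil (q : ℝ) : potential q ([] : List (FreeMagma α)) = 0 := rfl

@[simp] theorem potential_cons (q : ℝ) (t : FreeMagma α) (w : List (FreeMagma α)) :
    potential q (t :: w) = q ^ t.length + potential q w := by simp [potential]

theorem potential_replicate (q : ℝ) (n : ℕ) (t : FreeMagma α) :
    potential q (List.replicate n t) = n * q ^ t.length := by simp [potential]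

theorem potential_nonneg {q : ℝ} (hq : 0 ≤ q) (w : List (FreeMagma α)) : 0 ≤ potential q w := by
  induction w with
  | nil => simp
  | cons t w ih => rw [potential_cons]; positivity

@[simp] theorem crossWord_nil (T : FreeMagma α) : crossWord T [] = [] := rfl

@[simp] theorem crossWord_cons (T t : FreeMagma α) (w : List (FreeMagma α)) :
    crossWord T (t :: w) = T * t :: t :: crossWord T w := by simp [crossWord]

theorem mem_crossWord {T t : FreeMagma α} {w : List (FreeMagma α)} :
    t ∈ crossWord T w ↔ ∃ s ∈ w, t = T * s ∨ t = s := by simp [crossWord]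

theorem wordEval_crossWord (T : FreeMagma α) (w : List (FreeMagma α)) :
    commEval f T * wordEval f w = wordEval f (crossWord T w) * commEval f T := by
  induction w with
  | nil => simp
  | cons t w ih =>
    rw [crossWord_cons, wordEval_cons, wordEval_cons, wordEval_cons, mul_assoc, mul_assoc, ← ih,
      commEval_mul, commutatorElement_def]
    group

theorem potential_crossWord (q : ℝ) (T : FreeMagma α) (w : List (FreeMagma α)) :
    potential q (crossWord T w) = potential q w * (1 + q ^ T.length) := by
  induction w with
  | nil => simp
  | cons t w ih =>
    rw [crossWord_cons, potential_cons, potential_cons, potential_cons, ih, FreeMagma.length_mul',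
      pow_add]
    ring

variable [DecidableEq α]

theorem count_mul_pow_le_potential {q : ℝ} (hq : 0 ≤ q) (T : FreeMagma α)
    (w : List (FreeMagma α)) : w.count T * q ^ T.length ≤ potential q w := by
  induction w with
  | nil => simp
  | cons t w ih =>
    rw [potential_cons, List.count_cons]
    by_cases h : t = T
    · subst h
      simp only [BEq.rfl, if_true]
      push_cast
      linarith
    · have : 0 ≤ q ^ t.length := by positivity
      simp only [beq_iff_eq, h, if_false]
      push_cast
      linarith

theorem count_crossWord_of_forall_ne {T y : FreeMagma α} {w : List (FreeMagma α)}
    (h : ∀ t ∈ w, y ≠ T * t) : (crossWord T w).count y = w.count y := by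
  induction w with
  | nil => simp
  | cons t w ih =>
    rw [crossWord_cons, List.count_cons_of_ne (h t (by simp)).symm, List.count_cons, List.count_cons,
      ih fun s hs => h s (by simp [hs])]

theorem count_crossWord_mul (T x : FreeMagma α) (w : List (FreeMagma α)) :
    (crossWord T w).count (T * x) = w.count (T * x) + w.count x := by
  induction w with
  | nil => simp
  | cons t w ih =>
    simp only [crossWord_cons, List.count_cons, ih, beq_iff_eq, FreeMagma.mul_inj_right]
    omega

/-- Collecting all occurrences of the letter `T` at the right end of a word. -/
theorem exists_collect (T : FreeMagma α) {q : ℝ} (hq : 0 ≤ q) (w : List (FreeMagma α)) :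
    ∃ v : List (FreeMagma α), wordEval f w = wordEval f v * commEval f T ^ w.count T ∧
      potential q v ≤ potential q w * (1 + q ^ T.length) ^ w.count T ∧
      (∀ P : FreeMagma α → Prop, (∀ t ∈ w, t ≠ T → P t) → (∀ t, P t → P (T * t)) →
        ∀ t ∈ v, P t) ∧
      ∀ y, y ≠ T → (∀ t, y ≠ T * t) → v.count y = w.count y := by
  induction w with
  | nil => exact ⟨[], by simp⟩
  | cons x w ih =>
    obtain ⟨v, h1, h2, h3, h4⟩ := ih
    have hT : 0 ≤ q ^ T.length := by positivity
    by_cases hx : x = T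
    · subst hx
      refine ⟨crossWord x v, ?_, ?_, ?_, ?_⟩
      · rw [wordEval_cons, h1, ← mul_assoc, wordEval_crossWord, List.count_cons_self, pow_succ',
          mul_assoc]
      · rw [potential_crossWord, List.count_cons_self, potential_cons, pow_succ, ← mul_assoc]
        gcongr
        refine h2.trans ?_
        gcongr
        linarith
      · intro P hP hmul t ht
        have := h3 P (fun t ht => hP t (by simp [ht])) hmul
        obtain ⟨s, hs, rfl | rfl⟩ := mem_crossWord.1 ht
        · exact hmul _ (this _ hs)
        · exact this _ hs
      · intro y hy hy'
        rw [count_crossWord_of_forall_ne fun t _ => hy' t, h4 y hy hy', List.count_cons_of_ne hy.symm]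
    · refine ⟨x :: v, ?_, ?_, ?_, ?_⟩
      · rw [wordEval_cons, h1, ← mul_assoc, wordEval_cons, List.count_cons_of_ne hx]
      · rw [potential_cons, potential_cons, List.count_cons_of_ne hx, add_mul]
        gcongr
        exact le_mul_of_one_le_right (by positivity) (one_le_pow₀ (by linarith))
      · intro P hP hmul t ht
        rcases List.mem_cons.1 ht with rfl | ht
        · exact hP _ (by simp) hx
        · exact h3 P (fun t ht => hP t (by simp [ht])) hmul t ht
      · intro y hy hy'
        rw [List.count_cons, List.count_cons, h4 y hy hy']

theorem pow_one_add_le_exp_potential {q : ℝ} (hq : 0 ≤ q) (T : FreeMagma α)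
    (w : List (FreeMagma α)) :
    (1 + q ^ T.length) ^ w.count T ≤ Real.exp (potential q w) := by
  have hT : 0 ≤ q ^ T.length := by positivity
  calc (1 + q ^ T.length) ^ w.count T ≤ Real.exp (q ^ T.length) ^ w.count T := by
        gcongr
        linarith [Real.add_one_le_exp (q ^ T.length)]
    _ = Real.exp (w.count T * q ^ T.length) := (Real.exp_nat_mul _ _).symm
    _ ≤ _ := Real.exp_le_exp.2 (count_mul_pow_le_potential hq T w)

/-- The word left over after collecting a letter has potential bounded in terms of the original
potential. -/
theorem exists_collect_of_potential_le (T : FreeMagma α) {q C : ℝ} (hq : 0 ≤ q)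
    {w : List (FreeMagma α)} (hw : potential q w ≤ C) :
    ∃ v : List (FreeMagma α), wordEval f w = wordEval f v * commEval f T ^ w.count T ∧
      potential q v ≤ C * Real.exp C ∧
      (∀ P : FreeMagma α → Prop, (∀ t ∈ w, t ≠ T → P t) → (∀ t, P t → P (T * t)) →
        ∀ t ∈ v, P t) ∧
      ∀ y, y ≠ T → (∀ t, y ≠ T * t) → v.count y = w.count y := by
  obtain ⟨v, h1, h2, h3⟩ := exists_collect f T hq w
  have h0 := potential_nonneg hq w
  refine ⟨v, h1, h2.trans ?_, h3⟩
  refine mul_le_mul hw ((pow_one_add_le_exp_potential hq T w).trans (Real.exp_le_exp.2 hw)) ?_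
    (h0.trans hw)
  positivity

/-- Moving `T ^ b` across `x ^ d`. -/
theorem exists_cross_pow (T x : FreeMagma α) (q : ℝ) (b d : ℕ) :
    ∃ v : List (FreeMagma α),
      commEval f T ^ b * commEval f x ^ d = wordEval f v * commEval f T ^ b ∧
      potential q v = d * q ^ x.length * (1 + q ^ T.length) ^ b ∧
      (∀ t ∈ v, t = x ∨ t = T * x ∨ T.length + x.length < t.length) ∧
      v.count x = d ∧ v.count (T * x) = b * d := by
  induction b with
  | zero =>
    refine ⟨List.replicate d x, ?_, ?_, ?_, ?_, ?_⟩
    · simp [wordEval_replicate]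
    · simp [potential_replicate]
    · intro t ht
      exact .inl (List.eq_of_mem_replicate ht)
    · simp
    · rw [List.count_replicate, if_neg]
      · simp
      · simpa using (FreeMagma.mul_ne_right T x).symm
  | succ b ih =>
    obtain ⟨v, h1, h2, h3, h4, h5⟩ := ih
    refine ⟨crossWord T v, ?_, ?_, ?_, ?_, ?_⟩
    · rw [pow_succ', mul_assoc, h1, ← mul_assoc, wordEval_crossWord, mul_assoc]
    · rw [potential_crossWord, h2, pow_succ, mul_assoc]
    · intro t ht
      obtain ⟨s, hs, rfl | rfl⟩ := mem_crossWord.1 ht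
      · have := T.length_pos
        rcases h3 s hs with rfl | rfl | h
        · exact .inr (.inl rfl)
        · right; right
          simp only [FreeMagma.length_mul']
          omega
        · right; right
          rw [FreeMagma.length_mul']
          omega
      · exact h3 _ hs
    · rw [count_crossWord_of_forall_ne, h4]
      intro t ht h
      have h' := congrArg FreeMagma.length h
      have := T.length_pos
      rw [FreeMagma.length_mul'] at h'
      rcases h3 t ht with rfl | rfl | h
      · omega
      · rw [FreeMagma.length_mul'] at h'
        omega
      · omega
    · rw [count_crossWord_mul, h4, h5]
      ring

/-- Up to a word in letters of higher weight, `⁅T ^ b, x ^ d⁆` is `⁅T, x⁆ ^ (b * d)`. -/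
theorem exists_commutator_pow_eq {T x : FreeMagma α} (hne : T ≠ x) {q B D : ℝ} (hq : 0 ≤ q)
    {b d : ℕ} (hb : b * q ^ T.length ≤ B) (hd : d * q ^ x.length ≤ D) :
    ∃ v : List (FreeMagma α),
      ⁅commEval f T ^ b, commEval f x ^ d⁆ = wordEval f v * commEval f (T * x) ^ (b * d) ∧
      potential q v ≤ (D * Real.exp B * Real.exp (D * Real.exp B)) *
        Real.exp (D * Real.exp B * Real.exp (D * Real.exp B)) ∧
      ∀ t ∈ v, T.length + x.length < t.length := by
  obtain ⟨u, h1, h2, h3, h4, h5⟩ := exists_cross_pow f T x q b d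
  have hT : 0 ≤ q ^ T.length := by positivity
  have hu : potential q u ≤ D * Real.exp B := by
    rw [h2]
    have : (1 + q ^ T.length) ^ b ≤ Real.exp B := by
      calc (1 + q ^ T.length) ^ b ≤ Real.exp (q ^ T.length) ^ b := by
            gcongr
            linarith [Real.add_one_le_exp (q ^ T.length)]
        _ = Real.exp (b * q ^ T.length) := (Real.exp_nat_mul _ _).symm
        _ ≤ _ := Real.exp_le_exp.2 hb
    refine mul_le_mul hd this (by positivity) (le_trans (by positivity) hd)
  obtain ⟨v, g1, g2, g3, g4⟩ := exists_collect_of_potential_le f x hq hu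
  obtain ⟨w, k1, k2, k3, -⟩ := exists_collect_of_potential_le f (T * x) hq g2
  have hv : ∀ t ∈ v, t = T * x ∨ T.length + x.length < t.length := by
    refine g3 _ (fun t ht htx => (h3 t ht).resolve_left htx) ?_
    rintro t (rfl | h)
    · right
      have := x.length_pos
      simp only [FreeMagma.length_mul']
      omega
    · right
      rw [FreeMagma.length_mul']
      omega
  refine ⟨w, ?_, k2, ?_⟩
  · rw [g4 _ (FreeMagma.mul_ne_right T x) fun t h => hne (FreeMagma.mul_inj_left h), h5] at k1
    rw [h4, k1] at g1
    rw [commutatorElement_def, h1, g1]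
    group
  · refine k3 _ (fun t ht htx => (hv t ht).resolve_left htx) fun t ht => ?_
    rw [FreeMagma.length_mul']
    omega

end Words

section Families

variable {ι G α : Type*} [Group G]

/-- The functions `a` with `a = O(N ^ k)`. -/
def PolyBounded (N : ι → ℕ) (k : ℕ) (a : ι → ℕ) : Prop :=
  ∃ C : ℕ, ∀ i, a i ≤ C * N i ^ k

/-- All families of words in letters of weight at least `k` whose potential at scale `N` is bounded
have values in `H`. -/
def WordsMem (N : ι → ℕ) (f : α → G) (H : Subgroup (ι → G)) (k : ℕ) : Prop :=
  ∀ (w : ι → List (FreeMagma α)) (C : ℝ), (∀ i, potential (N i : ℝ)⁻¹ (w i) ≤ C) →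
    (∀ i, ∀ t ∈ w i, k ≤ t.length) → (fun i => wordEval f (w i)) ∈ H

/-- The families of powers of `u` with exponents `O(N ^ k)` are in `H`, where `k` is the weight
of `u`. -/
def PowersMem (N : ι → ℕ) (f : α → G) (H : Subgroup (ι → G)) (u : FreeMagma α) : Prop :=
  ∀ a : ι → ℕ, PolyBounded N u.length a → (fun i => commEval f u ^ a i) ∈ H

/-- The families of elements of the `m`-th term of the lower central series. -/
def pointwiseLCS (ι G : Type*) [Group G] (m : ℕ) : Subgroup (ι → G) :=
  Subgroup.pi Set.univ fun _ => (⊤ : Subgroup G).lowerCentralSeries m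

theorem mem_pointwiseLCS {m : ℕ} {x : ι → G} :
    x ∈ pointwiseLCS ι G m ↔ ∀ i, x i ∈ (⊤ : Subgroup G).lowerCentralSeries m := by
  simp [pointwiseLCS, Subgroup.mem_pi]

instance pointwiseLCS_normal (m : ℕ) : (pointwiseLCS ι G m).Normal where
  conj_mem x hx g := by
    rw [mem_pointwiseLCS] at *
    exact fun i => Subgroup.Normal.conj_mem inferInstance _ (hx i) _

theorem commutator_mem_pointwiseLCS_left {m : ℕ} {x : ι → G} (hx : x ∈ pointwiseLCS ι G m)
    (y : ι → G) : ⁅x, y⁆ ∈ pointwiseLCS ι G (m + 1) := by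
  rw [mem_pointwiseLCS] at *
  exact fun i => Subgroup.commutator_mem_commutator (hx i) (Subgroup.mem_top _)

theorem commutator_mem_pointwiseLCS_right {m : ℕ} {y : ι → G} (hy : y ∈ pointwiseLCS ι G m)
    (x : ι → G) : ⁅x, y⁆ ∈ pointwiseLCS ι G (m + 1) := by
  rw [← inv_mem_iff, commutatorElement_inv]
  exact commutator_mem_pointwiseLCS_left hy x

/-- Commutators of elements of `H` up to an error in one term of the lower central series lie in
`H` up to an error in the next term. -/
theorem commutator_mem_sup_pointwiseLCS {H : Subgroup (ι → G)} {m : ℕ} {x y : ι → G}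
    (hx : x ∈ H ⊔ pointwiseLCS ι G m) (hy : y ∈ H ⊔ pointwiseLCS ι G m) :
    ⁅x, y⁆ ∈ H ⊔ pointwiseLCS ι G (m + 1) := by
  obtain ⟨h, hh, z, hz, rfl⟩ := Subgroup.mem_sup_of_normal_right.1 hx
  obtain ⟨h', hh', z', hz', rfl⟩ := Subgroup.mem_sup_of_normal_right.1 hy
  have hH : H ≤ H ⊔ pointwiseLCS ι G (m + 1) := le_sup_left
  have hL : pointwiseLCS ι G (m + 1) ≤ H ⊔ pointwiseLCS ι G (m + 1) := le_sup_right
  rw [commutatorElement_mul_left_eq_conj_mul, commutatorElement_mul_right_eq_mul_conj h,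
    mul_assoc ⁅h, h'⁆, mul_assoc ⁅h, h'⁆]
  have h1 := commutator_mem_pointwiseLCS_left hz (h' * z')
  have h2 := commutator_mem_pointwiseLCS_right hz' h
  refine mul_mem (hL ?_) (mul_mem (hH ?_) (hL ?_))
  · exact Subgroup.Normal.conj_mem inferInstance _ h1 _
  · rw [commutatorElement_def]
    exact mul_mem (mul_mem (mul_mem hh hh') (inv_mem hh)) (inv_mem hh')
  · exact Subgroup.Normal.conj_mem inferInstance _ h2 _

theorem commEval_mem_lowerCentralSeries (f : α → G) {m : ℕ} :
    ∀ {t : FreeMagma α}, 2 ^ m ≤ t.length →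
      commEval f t ∈ (⊤ : Subgroup G).lowerCentralSeries m := by
  induction m with
  | zero => simp
  | succ m ih =>
    intro t ht
    induction t with
    | ih1 a =>
      have := Nat.one_lt_two_pow (n := m + 1) (by omega)
      rw [FreeMagma.length] at ht
      omega
    | ih2 x y =>
      rw [FreeMagma.length_mul', pow_succ] at ht
      rw [commEval_mul]
      rcases le_or_gt (2 ^ m) x.length with hx | hx
      · exact Subgroup.commutator_mem_commutator (ih hx) (Subgroup.mem_top _)
      · rw [← inv_mem_iff, commutatorElement_inv]
        exact Subgroup.commutator_mem_commutator (ih (by omega)) (Subgroup.mem_top _)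

variable {N : ι → ℕ} {f : α → G} {H : Subgroup (ι → G)}

theorem PolyBounded.mul_inv_pow_le {k C : ℕ} {a : ι → ℕ} (h : ∀ i, a i ≤ C * N i ^ k) (i : ι) :
    a i * ((N i : ℝ)⁻¹) ^ k ≤ C := by
  rcases Nat.eq_zero_or_pos (N i ^ k) with h0 | h0
  · have := h i
    rw [h0, mul_zero, Nat.le_zero] at this
    simp [this]
  · rw [inv_pow, ← div_eq_mul_inv, div_le_iff₀ (by exact_mod_cast h0)]
    exact_mod_cast h i

theorem PolyBounded.of_mul_inv_pow_le (hN : ∀ i, 0 < N i) {k : ℕ} {C : ℝ} {a : ι → ℕ}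
    (h : ∀ i, a i * ((N i : ℝ)⁻¹) ^ k ≤ C) : PolyBounded N k a := by
  refine ⟨⌈C⌉₊, fun i => ?_⟩
  have hp : (0 : ℝ) < (N i : ℝ) ^ k := pow_pos (by exact_mod_cast hN i) k
  have := h i
  rw [inv_pow, ← div_eq_mul_inv, div_le_iff₀ hp] at this
  have h2 : (a i : ℝ) ≤ ⌈C⌉₊ * (N i : ℝ) ^ k :=
    this.trans (mul_le_mul_of_nonneg_right (Nat.le_ceil C) hp.le)
  exact_mod_cast h2

theorem WordsMem.powersMem {k : ℕ} (h : WordsMem N f H k) {u : FreeMagma α} (hu : k ≤ u.length) :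
    PowersMem N f H u := by
  rintro a ⟨C, hC⟩
  simp only [← wordEval_replicate]
  refine h (fun i => List.replicate (a i) u) C (fun i => ?_) fun i t ht => ?_
  · rw [potential_replicate]
    exact PolyBounded.mul_inv_pow_le hC i
  · rwa [List.eq_of_mem_replicate ht]

theorem finite_setOf_length_eq [Finite α] (k : ℕ) : {t : FreeMagma α | t.length = k}.Finite := by
  induction k using Nat.strong_induction_on with
  | _ k ih =>
    have hfin : ((Set.range (FreeMagma.of : α → FreeMagma α)) ∪
        ⋃ p ∈ Set.Iio k ×ˢ Set.Iio k, Set.image2 (· * ·) {t : FreeMagma α | t.length = p.1}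
          {t : FreeMagma α | t.length = p.2}).Finite := by
      refine (Set.finite_range _).union (((Set.finite_Iio k).prod (Set.finite_Iio k)).biUnion ?_)
      rintro ⟨i, j⟩ ⟨hi, hj⟩
      exact (ih i hi).image2 _ (ih j hj)
    refine hfin.subset fun t ht => ?_
    induction t with
    | ih1 a => exact .inl ⟨a, rfl⟩
    | ih2 x y =>
      right
      have hx := x.length_pos
      have hy := y.length_pos
      rw [Set.mem_ofPred_eq, FreeMagma.length_mul'] at ht
      simp only [Set.mem_iUnion]
      exact ⟨(x.length, y.length), ⟨by simp; omega, by simp; omega⟩, x, rfl, y, rfl, rfl⟩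

variable [DecidableEq α]

/-- Words of weight at least `k` are handled by collecting the letters of weight `k`. -/
theorem WordsMem.of_succ [Finite α] (hN : ∀ i, 0 < N i) {k : ℕ} (h : WordsMem N f H (k + 1))
    (hp : ∀ u : FreeMagma α, u.length = k → PowersMem N f H u) : WordsMem N f H k := by
  have key : ∀ F : Finset (FreeMagma α), (∀ t ∈ F, t.length = k) →
      ∀ (w : ι → List (FreeMagma α)) (C : ℝ), (∀ i, potential (N i : ℝ)⁻¹ (w i) ≤ C) →
        (∀ i, ∀ t ∈ w i, t ∈ F ∨ k + 1 ≤ t.length) → (fun i => wordEval f (w i)) ∈ H := by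
    intro F
    induction F using Finset.induction_on with
    | empty =>
      intro _ w C hC hw
      exact h w C hC fun i t ht => by simpa using hw i t ht
    | insert T F hTF ih =>
      intro hF w C hC hw
      have hT : T.length = k := hF T (by simp)
      have hq : ∀ i, (0 : ℝ) ≤ (N i : ℝ)⁻¹ := fun i => by positivity
      choose v h1 h2 h3 _ using fun i => exists_collect_of_potential_le f T (hq i) (hC i)
      have hv := ih (fun t ht => hF t (by simp [ht])) v _ h2 fun i => h3 i _ ?_ ?_
      · have hpow := hp T hT (fun i => (w i).count T) (.of_mul_inv_pow_le hN fun i =>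
          (count_mul_pow_le_potential (hq i) T (w i)).trans (hC i))
        have := mul_mem hv hpow
        convert this using 1
        funext i
        exact h1 i
      · intro t ht hne
        simpa [hne] using hw i t ht
      · intro t ht
        right
        have := t.length_pos
        rw [FreeMagma.length_mul']
        rcases ht with ht | ht
        · have := T.length_pos
          omega
        · omega
  intro w C hC hw
  refine key (finite_setOf_length_eq k).toFinset (by simp) w C hC fun i t ht => ?_
  have := hw i t ht
  simp only [Set.Finite.mem_toFinset, Set.mem_ofPred_eq]
  omega

/-- Powers of a commutator `⁅T, x⁆` are obtained from commutators of powers of `T` and `x`. -/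
theorem PowersMem.mul (hN : ∀ i, 0 < N i) {m : ℕ} {T x : FreeMagma α}
    (hT : PowersMem N f (H ⊔ pointwiseLCS ι G m) T) (hx : PowersMem N f (H ⊔ pointwiseLCS ι G m) x)
    (hw : WordsMem N f (H ⊔ pointwiseLCS ι G (m + 1)) (T.length + x.length + 1)) :
    PowersMem N f (H ⊔ pointwiseLCS ι G (m + 1)) (T * x) := by
  by_cases hne : T = x
  · subst hne
    intro a _
    convert one_mem (H ⊔ pointwiseLCS ι G (m + 1)) using 1
    funext i
    simp [commEval_mul]
  have key : ∀ b d : ι → ℕ, PolyBounded N T.length b → PolyBounded N x.length d →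
      (fun i => commEval f (T * x) ^ (b i * d i)) ∈ H ⊔ pointwiseLCS ι G (m + 1) := by
    intro b d hb hd
    have hcomm := commutator_mem_sup_pointwiseLCS (hT b hb) (hx d hd)
    obtain ⟨B, hB⟩ := hb
    obtain ⟨D, hD⟩ := hd
    have hq : ∀ i, (0 : ℝ) ≤ (N i : ℝ)⁻¹ := fun i => by positivity
    choose v h1 h2 h3 using fun i => exists_commutator_pow_eq f hne (hq i)
      (PolyBounded.mul_inv_pow_le hB i) (PolyBounded.mul_inv_pow_le hD i)
    have hv := hw v _ h2 h3
    have := mul_mem (inv_mem hv) hcomm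
    convert this using 1
    funext i
    simp only [Pi.mul_apply, Pi.inv_apply]
    rw [eq_inv_mul_iff_mul_eq]
    exact (h1 i).symm
  rintro a ⟨C, hC⟩
  have h1 := key (fun i => a i / N i ^ x.length) (fun i => N i ^ x.length) ?_ ⟨1, by simp⟩
  · have h2 := key (fun _ => 1) (fun i => a i % N i ^ x.length) ?_ ?_
    · convert mul_mem h1 h2 using 1
      funext i
      rw [Pi.mul_apply, ← pow_add, one_mul, mul_comm, Nat.div_add_mod]
    · exact ⟨1, fun i => by simpa using Nat.one_le_iff_ne_zero.2 (pow_pos (hN i) _).ne'⟩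
    · exact ⟨1, fun i => by simpa using (Nat.mod_lt _ (pow_pos (hN i) _)).le⟩
  · refine ⟨C, fun i => ?_⟩
    rw [Nat.div_le_iff_le_mul_add_pred (pow_pos (hN i) _)]
    have := hC i
    rw [FreeMagma.length_mul', pow_add] at this
    nlinarith

/-- If `H` contains the families of powers of the generators with exponents `O(N)`, then it contains
the values of all families of words of bounded potential. -/
theorem wordsMem_of_powersMem_of [Group.IsNilpotent G] [Finite α] (hN : ∀ i, 0 < N i)
    (hH : ∀ a : α, PowersMem N f H (.of a)) : WordsMem N f H 0 := by
  have key : ∀ m, WordsMem N f (H ⊔ pointwiseLCS ι G m) 0 := by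
    intro m
    induction m with
    | zero =>
      intro w C _ _
      exact (le_sup_right : _ ≤ H ⊔ pointwiseLCS ι G 0) (mem_pointwiseLCS.2 fun i => by simp)
    | succ m ih =>
      suffices h : ∀ j k, 2 ^ (m + 1) ≤ k + j →
          WordsMem N f (H ⊔ pointwiseLCS ι G (m + 1)) k from h (2 ^ (m + 1)) 0 (by simp)
      intro j
      induction j with
      | zero =>
        intro k hk w C _ hw
        refine (le_sup_right : _ ≤ H ⊔ pointwiseLCS ι G (m + 1)) (mem_pointwiseLCS.2 fun i => ?_)
        refine list_prod_mem fun g hg => ?_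
        obtain ⟨t, ht, rfl⟩ := List.mem_map.1 hg
        exact commEval_mem_lowerCentralSeries f (hk.trans (hw i t ht))
      | succ j ihj =>
        intro k hk
        have hk' := ihj (k + 1) (by omega)
        refine hk'.of_succ hN fun u hu => ?_
        induction u with
        | ih1 a => exact fun b hb => (le_sup_left : H ≤ _) (hH a b hb)
        | ih2 T x =>
          rw [FreeMagma.length_mul'] at hu
          exact .mul hN (ih.powersMem (Nat.zero_le _)) (ih.powersMem (Nat.zero_le _)) (hu ▸ hk')
  obtain ⟨c, hc⟩ := Subgroup.nilpotent_iff_lowerCentralSeries.1 (inferInstance : Group.IsNilpotent G)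
  have hbot : pointwiseLCS ι G c = ⊥ := by
    rw [eq_bot_iff]
    intro x hx
    rw [mem_pointwiseLCS, hc] at hx
    exact Subgroup.mem_bot.2 (funext fun i => Subgroup.mem_bot.1 (hx i))
  simpa [hbot] using key c

end Families

/-- The families of elements which are products of a bounded number of powers of elements of `S`
with total exponent `O(N)`. -/
def boundedPowerProducts {ι G : Type*} [Group G] (S : Set G) (hS : ∀ s ∈ S, s⁻¹ ∈ S) (N : ι → ℕ) :
    Subgroup (ι → G) where
  carrier := {x | ∃ K : ℕ, ∀ i, ∃ l : List (G × ℕ), l.length ≤ K ∧ (∀ p ∈ l, p.1 ∈ S) ∧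
    (l.map Prod.snd).sum ≤ K * N i ∧ (l.map fun p => p.1 ^ p.2).prod = x i}
  one_mem' := ⟨0, fun i => ⟨[], by simp⟩⟩
  mul_mem' := by
    rintro x y ⟨K, hK⟩ ⟨M, hM⟩
    refine ⟨K + M, fun i => ?_⟩
    obtain ⟨l, h1, h2, h3, h4⟩ := hK i
    obtain ⟨r, g1, g2, g3, g4⟩ := hM i
    refine ⟨l ++ r, ?_, ?_, ?_, ?_⟩
    · rw [List.length_append]
      omega
    · intro p hp
      exact (List.mem_append.1 hp).elim (h2 p) (g2 p)
    · rw [List.map_append, List.sum_append, add_mul]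
      omega
    · rw [List.map_append, List.prod_append, h4, g4, Pi.mul_apply]
  inv_mem' := by
    rintro x ⟨K, hK⟩
    refine ⟨K, fun i => ?_⟩
    obtain ⟨l, h1, h2, h3, h4⟩ := hK i
    refine ⟨(l.map fun p => (p.1⁻¹, p.2)).reverse, by simpa using h1, ?_, ?_, ?_⟩
    · intro p hp
      rw [List.mem_reverse, List.mem_map] at hp
      obtain ⟨r, hr, rfl⟩ := hp
      exact hS _ (h2 r hr)
    · rw [List.map_reverse, List.sum_reverse, List.map_map]
      exact h3
    · rw [Pi.inv_apply, ← h4, List.prod_inv_reverse, List.map_reverse, List.map_map, List.map_map]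
      simp [Function.comp_def]

theorem exists_list_length_eq_wlen {G : Type*} [Group G] {S : Set G} (hS : ∀ s ∈ S, s⁻¹ ∈ S)
    (hgen : Subgroup.closure S = ⊤) (g : G) :
    ∃ l : List G, (∀ s ∈ l, s ∈ S) ∧ l.length = wlen S g ∧ l.prod = g := by
  have hg : g ∈ Submonoid.closure S := by
    have : g ∈ (Subgroup.closure S).toSubmonoid := by simp [hgen]
    rwa [Subgroup.closure_toSubmonoid, Set.union_eq_self_of_subset_right] at this
    exact fun s hs => inv_inv s ▸ hS _ hs
  obtain ⟨l, h1, h2⟩ := Submonoid.exists_list_of_mem_closure hg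
  exact Nat.sInf_mem (s := {n | ∃ l : List G, (∀ s ∈ l, s ∈ S) ∧ l.length = n ∧ l.prod = g})
    ⟨l.length, l, h1, rfl, h2⟩

theorem stmt4 {G : Type*} [Group G] [Group.IsNilpotent G]
    (S : Set G) (hSfin : S.Finite) (hSsymm : ∀ s ∈ S, s⁻¹ ∈ S)
    (hSgen : Subgroup.closure S = ⊤) :
    ∃ K : ℕ, 0 < K ∧ ∀ g : G, ∃ l : List (G × ℕ),
      l.length ≤ K ∧ (∀ p ∈ l, p.1 ∈ S) ∧
      (l.map Prod.snd).sum ≤ K * wlen S g ∧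
      (l.map fun p => p.1 ^ p.2).prod = g := by
  classical
  have : Finite S := hSfin
  let N : {g : G // 0 < wlen S g} → ℕ := fun g => wlen S g.1
  have hN : ∀ g, 0 < N g := fun g => g.2
  have hwords : WordsMem N (Subtype.val : S → G) (boundedPowerProducts S hSsymm N) 0 := by
    refine wordsMem_of_powersMem_of hN fun s a ha => ?_
    obtain ⟨C, hC⟩ := ha
    refine ⟨C + 1, fun i => ⟨[(s.1, a i)], by simp, by simp, ?_, by simp [commEval_of]⟩⟩
    have := hC i
    simp only [FreeMagma.length, pow_one] at this
    simp only [List.map_cons, List.map_nil, List.sum_cons, List.sum_nil]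
    nlinarith
  choose w h1 h2 h3 using exists_list_length_eq_wlen hSsymm hSgen
  have hid := hwords (fun g => (w g.1).attach.map fun s => .of ⟨s.1, h1 g.1 s.1 s.2⟩) 1
    (fun g => ?_) (fun _ _ _ => Nat.zero_le _)
  · obtain ⟨K, hK⟩ := hid
    refine ⟨K + 1, by omega, fun g => ?_⟩
    rcases Nat.eq_zero_or_pos (wlen S g) with h0 | h0
    · refine ⟨[], by simp, by simp, by simp, ?_⟩
      have := h2 g
      rw [h0, List.length_eq_zero_iff] at this
      rw [← h3 g, this]
      rfl
    · obtain ⟨l, g1, g2, g3, g4⟩ := hK ⟨g, h0⟩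
      refine ⟨l, by omega, g2, g3.trans (Nat.mul_le_mul_right _ (by omega)), g4.trans ?_⟩
      simp [wordEval, Function.comp_def, commEval_of, h3]
  · have hpos : (0 : ℝ) < N g := by exact_mod_cast hN g
    have hlen : (w g.1).length = N g := h2 g.1
    simp [potential, Function.comp_def, FreeMagma.length, hlen, hpos.ne']
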